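/- Let C ≥ 1 and let ω : ℝ → ℝ satisfy 1 ≤ ω(x) ≤ C for all x ∈ I = (−1,1); assume there is a finite set S_ω ⊆ I such that ω is continuous on I∖S_ω and at every x ∈ I the one-sided limits ω(x⁻) and ω(x⁺) exist, and set ω⁻(x) := min{ω(x⁻), ω(x⁺)}. Let S ⊆ I be a finite set and let u : ℝ → ℝ be locally absolutely continuous on I∖S with a.e. derivative u′, such that at every x ∈ S the one-sided limits u(x⁻) and u(x⁺) exist and are distinct. Let (εₙ) be positive reals with εₙ → 0, and for each n let uₙ, vₙ : ℝ → ℝ be locally absolutely continuous on I with a.e. derivatives gₙ, hₙ, with 0 ≤ vₙ ≤ 1 on I, ∫_I |uₙ − u| ω dx → 0, and ∫_I |vₙ − 1| dx → 0. Then liminf_{n→∞} ( ∫_I vₙ² gₙ² ω dx + ∫_I [ (εₙ/2) hₙ² + (1/(2εₙ)) (vₙ − 1)² ] ω dx ) ≥ ∫_I |u′|² ω dx + Σ_{x ∈ S} ω⁻(x), where all energy integrals are Lebesgue integrals with values in [0,∞]. -/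

import Mathlib

open MeasureTheory Filter Set
open scoped ENNReal

/-- `f` is absolutely continuous on `[a, b]` with a.e. derivative `f'`, encoded via the
fundamental theorem of calculus for the Lebesgue integral. -/
def ACderivOn (f f' : ℝ → ℝ) (a b : ℝ) : Prop :=
  IntervalIntegrable f' volume a b ∧
    ∀ x ∈ Set.Icc a b, f x = f a + ∫ t in a..x, f' t

/-- `f` is locally absolutely continuous on the open set `U` with a.e. derivative `f'`:
it is absolutely continuous with derivative `f'` on every compact subinterval of `U`. -/
def LocACOn (f f' : ℝ → ℝ) (U : Set ℝ) : Prop :=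
  ∀ a b : ℝ, a ≤ b → Set.Icc a b ⊆ U → ACderivOn f f' a b

open scoped Topology

lemma ACderivOn.absolutelyContinuousOnInterval {f f' : ℝ → ℝ} {a b : ℝ} (hab : a ≤ b)
    (h : ACderivOn f f' a b) : AbsolutelyContinuousOnInterval f a b := by
  have h1 := (h.1.absolutelyContinuousOnInterval_intervalIntegral
    (left_mem_uIcc : a ∈ uIcc a b))
  have h2 : AbsolutelyContinuousOnInterval (fun _ : ℝ => f a) a b :=
    (LipschitzWith.const (f a)).lipschitzOnWith.absolutelyContinuousOnInterval
  have h3 := h2.add h1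
  unfold AbsolutelyContinuousOnInterval at h3 ⊢
  refine h3.congr' ?_
  have : ∀ᶠ E in AbsolutelyContinuousOnInterval.totalLengthFilter ⊓
      𝓟 (AbsolutelyContinuousOnInterval.disjWithin a b),
      E ∈ AbsolutelyContinuousOnInterval.disjWithin a b := eventually_inf_principal.mpr (by simp)
  filter_upwards [this] with E hE
  refine Finset.sum_congr rfl fun i hi => ?_
  have := hE.1 i hi
  rw [uIcc_of_le hab] at this
  rw [h.2 _ this.1, h.2 _ this.2]
  rfl

lemma ACderivOn.continuousOn {f f' : ℝ → ℝ} {a b : ℝ} (hab : a ≤ b)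
    (h : ACderivOn f f' a b) : ContinuousOn f (Icc a b) := by
  simpa [uIcc_of_le hab] using (h.absolutelyContinuousOnInterval hab).continuousOn

lemma ACderivOn.ae_hasDerivAt {f f' : ℝ → ℝ} {a b : ℝ} (hab : a ≤ b)
    (h : ACderivOn f f' a b) : ∀ᵐ x, x ∈ Ioo a b → HasDerivAt f (f' x) x := by
  filter_upwards [h.1.ae_hasDerivAt_integral] with x hx hxab
  rw [uIcc_of_le hab] at hx
  have h1 := (hx (Ioo_subset_Icc_self hxab) a ⟨le_rfl, hab⟩).const_add (f a)
  refine h1.congr_of_eventuallyEq ?_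
  filter_upwards [isOpen_Ioo.mem_nhds hxab] with y hy
  exact h.2 y (Ioo_subset_Icc_self hy)

lemma ACderivOn.integral_deriv {f f' : ℝ → ℝ} {a b : ℝ} (hab : a ≤ b)
    (h : ACderivOn f f' a b) : ∫ t in a..b, f' t = f b - f a := by
  rw [h.2 b ⟨hab, le_rfl⟩]; ring

lemma ACderivOn.integral_mul_one_sub {v h : ℝ → ℝ} {a b : ℝ} (hab : a ≤ b)
    (hv : ACderivOn v h a b) :
    IntervalIntegrable (fun t => h t * (1 - v t)) volume a b ∧
    ∫ t in a..b, h t * (1 - v t) = ((1 - v a) ^ 2 - (1 - v b) ^ 2) / 2 := by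
  have hac := hv.absolutelyContinuousOnInterval hab
  have hint : IntervalIntegrable (fun t => h t * (1 - v t)) volume a b :=
    hv.1.mul_continuousOn (continuousOn_const.sub hac.continuousOn)
  have hint2 : IntervalIntegrable (fun t => h t * v t) volume a b :=
    hv.1.mul_continuousOn hac.continuousOn
  refine ⟨hint, ?_⟩
  have h1 := hac.integral_deriv_mul_eq_sub hac
  have h2 : ∫ x in a..b, deriv v x * v x + v x * deriv v x = ∫ x in a..b, 2 * (h x * v x) := by
    apply intervalIntegral.integral_congr_ae
    have hb : ∀ᵐ x : ℝ, x ≠ b := by simp [ae_iff, measure_singleton]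
    filter_upwards [hv.ae_hasDerivAt hab, hb] with x hx hxb hxm
    rw [uIoc_of_le hab] at hxm
    rw [(hx ⟨hxm.1, lt_of_le_of_ne hxm.2 hxb⟩).deriv]
    ring
  rw [h2, intervalIntegral.integral_const_mul] at h1
  have h3 : ∫ t in a..b, h t * (1 - v t) = (∫ t in a..b, h t) - ∫ t in a..b, h t * v t := by
    rw [← intervalIntegral.integral_sub hv.1 hint2]
    congr 1; ext t; ring
  rw [h3, hv.integral_deriv hab]
  linarith

lemma ofReal_integral_le_lintegral_ofReal {α : Type*} [MeasurableSpace α] {μ : Measure α}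
    {f : α → ℝ} (hf : Integrable f μ) :
    ENNReal.ofReal (∫ x, f x ∂μ) ≤ ∫⁻ x, ENNReal.ofReal (f x) ∂μ := by
  calc ENNReal.ofReal (∫ x, f x ∂μ) ≤ ENNReal.ofReal (∫ x, max (f x) 0 ∂μ) :=
        ENNReal.ofReal_le_ofReal (integral_mono hf hf.pos_part fun x => le_max_left _ _)
    _ = ∫⁻ x, ENNReal.ofReal (max (f x) 0) ∂μ :=
        ofReal_integral_eq_lintegral_ofReal hf.pos_part (ae_of_all _ fun x => le_max_right _ _)
    _ = ∫⁻ x, ENNReal.ofReal (f x) ∂μ := by simp [ENNReal.ofReal_max]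

lemma ofReal_mul_integral_le_setLIntegral_mul {s : Set ℝ} (hs : MeasurableSet s)
    {f X ω : ℝ → ℝ} {m : ℝ} (hm : 0 ≤ m) (hf : IntegrableOn f s)
    (hfX : ∀ x ∈ s, f x ≤ X x) (hX : ∀ x ∈ s, 0 ≤ X x)
    (hω : ∀ᵐ x ∂volume.restrict s, m ≤ ω x) :
    ENNReal.ofReal (m * ∫ x in s, f x) ≤ ∫⁻ x in s, ENNReal.ofReal (X x * ω x) := by
  rw [← integral_const_mul]
  refine (ofReal_integral_le_lintegral_ofReal (hf.const_mul m)).trans (lintegral_mono_ae ?_)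
  filter_upwards [hω, ae_restrict_mem hs] with x hx hxs
  refine ENNReal.ofReal_le_ofReal ?_
  nlinarith [mul_le_mul_of_nonneg_left (hfX x hxs) hm, mul_le_mul_of_nonneg_left hx (hX x hxs)]

/-- On a cell, either the phase field stays above `1 - η` and Jensen's inequality bounds the
energy, or it dips below `1 - η` and the Modica–Mortola trick does. -/
lemma ofReal_min_le_cell_energy {U : Set ℝ} {c d : ℝ} (hcd : c < d) (hU : Icc c d ⊆ U)
    {u g v h ω : ℝ → ℝ} (hu : LocACOn u g U) (hv : LocACOn v h U)
    {ε m η : ℝ} (hε : 0 < ε) (hm : 0 ≤ m)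
    (hη0 : 0 ≤ η) (hη1 : η ≤ 1) (hω : ∀ᵐ y ∂volume.restrict (Ioc c d), m ≤ ω y) :
    ENNReal.ofReal (m * min ((1 - η) ^ 2 * ((u d - u c) ^ 2 / (d - c)))
        (η ^ 2 - ((1 - v c) ^ 2 + (1 - v d) ^ 2) / 2)) ≤
      (∫⁻ x in Ioc c d, ENNReal.ofReal ((v x) ^ 2 * (g x) ^ 2 * ω x)) +
      ∫⁻ x in Ioc c d, ENNReal.ofReal (((ε / 2) * (h x) ^ 2 +
            (1 / (2 * ε)) * (v x - 1) ^ 2) * ω x) := by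
  have hd : 0 < d - c := sub_pos.2 hcd
  by_cases hall : ∀ y ∈ Icc c d, 1 - η ≤ v y
  · refine le_trans ?_ le_self_add
    have hac := hu c d hcd.le hU
    set l : ℝ := (u d - u c) / (d - c) with hl
    have hgi : IntegrableOn g (Ioc c d) :=
      (intervalIntegrable_iff_integrableOn_Ioc_of_le hcd.le).1 hac.1
    have hgi' : IntegrableOn (fun x => (1 - η) ^ 2 * (2 * l * g x - l ^ 2)) (Ioc c d) :=
      ((hgi.const_mul (2 * l)).sub (integrable_const (l ^ 2))).const_mul _
    have hint : ∫ x in Ioc c d, (1 - η) ^ 2 * (2 * l * g x - l ^ 2) =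
        (1 - η) ^ 2 * ((u d - u c) ^ 2 / (d - c)) := by
      rw [integral_const_mul, integral_sub (hgi.const_mul _) (integrable_const _),
        integral_const_mul, ← intervalIntegral.integral_of_le hcd.le, hac.integral_deriv hcd.le]
      simp only [integral_const, measureReal_restrict_apply_univ, Real.volume_real_Ioc_of_le hcd.le,
        smul_eq_mul, hl]
      field_simp
      ring
    have key := ofReal_mul_integral_le_setLIntegral_mul (s := Ioc c d) measurableSet_Ioc
      (f := fun x => (1 - η) ^ 2 * (2 * l * g x - l ^ 2)) (X := fun x => (v x) ^ 2 * (g x) ^ 2)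
      hm hgi' (fun x hx => ?_)
      (fun x _ => by positivity) hω
    · rw [hint] at key
      refine le_trans (ENNReal.ofReal_le_ofReal ?_) key
      exact mul_le_mul_of_nonneg_left (min_le_left _ _) hm
    · have h1 := hall x (Ioc_subset_Icc_self hx)
      have h2 : (1 - η) ^ 2 ≤ (v x) ^ 2 := pow_le_pow_left₀ (by linarith) h1 2
      nlinarith [mul_le_mul_of_nonneg_right h2 (sq_nonneg (g x)),
        mul_nonneg (sq_nonneg (1 - η)) (sq_nonneg (g x - l))]
  · push Not at hall
    obtain ⟨y, hy, hvy⟩ := hall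
    refine le_trans ?_ le_add_self
    have hpt : ∀ x, |h x * (1 - v x)| ≤ (ε / 2) * (h x) ^ 2 + (1 / (2 * ε)) * (v x - 1) ^ 2 := by
      intro x
      have e : (ε / 2) * (h x) ^ 2 + (1 / (2 * ε)) * (v x - 1) ^ 2 =
          ((ε * h x) ^ 2 + (1 - v x) ^ 2) / (2 * ε) := by field_simp; ring
      rw [e, le_div_iff₀ (by positivity), ← abs_of_pos (show 0 < 2 * ε by positivity), ← abs_mul]
      rw [abs_le]
      constructor <;> nlinarith [sq_nonneg (ε * h x - (1 - v x)), sq_nonneg (ε * h x + (1 - v x))]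
    have hl := (hv c y hy.1 ((Icc_subset_Icc_right hy.2).trans hU)).integral_mul_one_sub hy.1
    have hr := (hv y d hy.2 ((Icc_subset_Icc_left hy.1).trans hU)).integral_mul_one_sub hy.2
    have hL := hl.2 ▸ intervalIntegral.abs_integral_le_integral_abs (μ := volume)
      (f := fun t => h t * (1 - v t)) hy.1
    have hR := hr.2 ▸ intervalIntegral.abs_integral_le_integral_abs (μ := volume)
      (f := fun t => h t * (1 - v t)) hy.2
    have hi := hl.1.abs.trans hr.1.abs
    have hsum := intervalIntegral.integral_add_adjacent_intervals hl.1.abs hr.1.abs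
    have key := ofReal_mul_integral_le_setLIntegral_mul (s := Ioc c d) measurableSet_Ioc
      (f := fun x => |h x * (1 - v x)|) hm
      ((intervalIntegrable_iff_integrableOn_Ioc_of_le hcd.le).1 hi) (fun x _ => hpt x)
      (fun x _ => (abs_nonneg _).trans (hpt x)) hω
    refine le_trans (ENNReal.ofReal_le_ofReal (mul_le_mul_of_nonneg_left ?_ hm)) key
    refine (min_le_right _ _).trans ?_
    rw [← intervalIntegral.integral_of_le hcd.le, ← hsum]
    have h1 := neg_abs_le (((1 - v c) ^ 2 - (1 - v y) ^ 2) / 2)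
    have h2 := le_abs_self (((1 - v y) ^ 2 - (1 - v d) ^ 2) / 2)
    have h3 : η ^ 2 ≤ (1 - v y) ^ 2 := pow_le_pow_left₀ hη0 (by linarith) 2
    linarith

lemma sum_ofReal_min_le_of_energy_le {ι : Type*} (s : Finset ι) {U : Set ℝ} {c d : ι → ℝ}
    (hcd : ∀ i ∈ s, c i < d i) (hU : ∀ i ∈ s, Icc (c i) (d i) ⊆ U)
    (hdisj : (s : Set ι).PairwiseDisjoint fun i => Ioc (c i) (d i))
    {u ω : ℝ → ℝ} {un gn vn hn : ℕ → ℝ → ℝ} {ε : ℕ → ℝ}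
    (hu : ∀ n, LocACOn (un n) (gn n) U) (hv : ∀ n, LocACOn (vn n) (hn n) U)
    (hε : ∀ n, 0 < ε n) {m η : ι → ℝ} (hm : ∀ i ∈ s, 0 ≤ m i)
    (hη0 : ∀ i ∈ s, 0 ≤ η i) (hη1 : ∀ i ∈ s, η i ≤ 1)
    (hω : ∀ i ∈ s, ∀ᵐ y ∂volume.restrict (Ioc (c i) (d i)), m i ≤ ω y)
    (hc : ∀ i ∈ s, Tendsto (fun n => un n (c i)) atTop (𝓝 (u (c i))) ∧
      Tendsto (fun n => vn n (c i)) atTop (𝓝 1))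
    (hd : ∀ i ∈ s, Tendsto (fun n => un n (d i)) atTop (𝓝 (u (d i))) ∧
      Tendsto (fun n => vn n (d i)) atTop (𝓝 1))
    {A : ℝ≥0∞} (hA : ∀ n, (∫⁻ x in U, ENNReal.ofReal ((vn n x) ^ 2 * (gn n x) ^ 2 * ω x)) +
      ∫⁻ x in U, ENNReal.ofReal (((ε n / 2) * (hn n x) ^ 2 +
        (1 / (2 * ε n)) * (vn n x - 1) ^ 2) * ω x) ≤ A) :
    ∑ i ∈ s, ENNReal.ofReal (m i * min ((1 - η i) ^ 2 *
      ((u (d i) - u (c i)) ^ 2 / (d i - c i))) (η i ^ 2)) ≤ A := by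
  have hlim : Tendsto (fun n => ∑ i ∈ s, ENNReal.ofReal (m i * min ((1 - η i) ^ 2 *
      ((un n (d i) - un n (c i)) ^ 2 / (d i - c i)))
      (η i ^ 2 - ((1 - vn n (c i)) ^ 2 + (1 - vn n (d i)) ^ 2) / 2))) atTop
      (𝓝 (∑ i ∈ s, ENNReal.ofReal (m i * min ((1 - η i) ^ 2 *
      ((u (d i) - u (c i)) ^ 2 / (d i - c i)))
      (η i ^ 2 - ((1 - 1) ^ 2 + (1 - 1) ^ 2) / 2)))) := by
    refine tendsto_finsetSum _ fun i hi => ENNReal.tendsto_ofReal (Tendsto.const_mul _ ?_)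
    obtain ⟨h1, h2⟩ := hc i hi
    obtain ⟨h3, h4⟩ := hd i hi
    exact (((((h3.sub h1).pow 2).div_const _).const_mul _)).min
      (tendsto_const_nhds.sub ((((tendsto_const_nhds.sub h2).pow 2).add
        ((tendsto_const_nhds.sub h4).pow 2)).div_const _))
  have hlim' : Tendsto (fun n => ∑ i ∈ s, ENNReal.ofReal (m i * min ((1 - η i) ^ 2 *
      ((un n (d i) - un n (c i)) ^ 2 / (d i - c i)))
      (η i ^ 2 - ((1 - vn n (c i)) ^ 2 + (1 - vn n (d i)) ^ 2) / 2))) atTop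
      (𝓝 (∑ i ∈ s, ENNReal.ofReal (m i * min ((1 - η i) ^ 2 *
      ((u (d i) - u (c i)) ^ 2 / (d i - c i))) (η i ^ 2)))) := by
    simpa using hlim
  refine le_of_tendsto' hlim' fun n => le_trans ?_ (hA n)
  have hsub : (⋃ i ∈ s, Ioc (c i) (d i)) ⊆ U :=
    iUnion₂_subset fun i hi => Ioc_subset_Icc_self.trans (hU i hi)
  refine le_trans ?_ (add_le_add (lintegral_mono_set hsub) (lintegral_mono_set hsub))
  rw [lintegral_biUnion_finset hdisj fun i _ => measurableSet_Ioc,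
    lintegral_biUnion_finset hdisj fun i _ => measurableSet_Ioc, ← Finset.sum_add_distrib]
  exact Finset.sum_le_sum fun i hi => ofReal_min_le_cell_energy (hcd i hi) (hU i hi) (hu n) (hv n)
    (hε n) (hm i hi) (hη0 i hi) (hη1 i hi) (hω i hi)

lemma HasDerivAt.tendsto_slope_straddle {f : ℝ → ℝ} {f' x : ℝ} (hf : HasDerivAt f f' x)
    {l : Filter ℕ} {c d : ℕ → ℝ} (hc : Tendsto c l (𝓝 x)) (hd : Tendsto d l (𝓝 x))
    (hcx : ∀ k, c k ≤ x) (hxd : ∀ k, x ≤ d k) (hcd : ∀ k, c k < d k) :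
    Tendsto (fun k => (f (d k) - f (c k)) / (d k - c k)) l (𝓝 f') := by
  rw [Metric.tendsto_nhds]
  intro e he
  have h := (hasDerivAt_iff_isLittleO.1 hf).def (half_pos he)
  filter_upwards [hc.eventually h, hd.eventually h] with k h1 h2
  have hpos : 0 < d k - c k := sub_pos.2 (hcd k)
  simp only [smul_eq_mul, Real.norm_eq_abs] at h1 h2
  rw [abs_of_nonpos (sub_nonpos.2 (hcx k)), abs_le] at h1
  rw [abs_of_nonneg (sub_nonneg.2 (hxd k)), abs_le] at h2
  have : (f (d k) - f (c k)) / (d k - c k) - f' =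
    (f (d k) - f (c k) - f' * (d k - c k)) / (d k - c k) := by field_simp
  rw [Real.dist_eq, this, abs_div, abs_of_pos hpos, div_lt_iff₀ hpos, abs_lt]
  constructor <;> nlinarith

lemma ofReal_mul_le_liminf {l : Filter ℕ} [NeBot l] {m b : ℕ → ℝ} {L B : ℝ}
    (hm : ∀ a < L, ∀ᶠ k in l, a ≤ m k) (hb : Tendsto b l (𝓝 B)) (hb0 : ∀ k, 0 ≤ b k) :
    ENNReal.ofReal (L * B) ≤ liminf (fun k => ENNReal.ofReal (m k * b k)) l := by
  have h1 : ∀ a < L, ENNReal.ofReal (a * B) ≤ liminf (fun k => ENNReal.ofReal (m k * b k)) l := by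
    intro a ha
    rw [← (ENNReal.tendsto_ofReal (hb.const_mul a)).liminf_eq]
    refine liminf_le_liminf ?_
    filter_upwards [hm a ha] with k hk
    exact ENNReal.ofReal_le_ofReal (mul_le_mul_of_nonneg_right hk (hb0 k))
  have h2 : Tendsto (fun a : ℝ => ENNReal.ofReal (a * B)) (𝓝[<] L) (𝓝 (ENNReal.ofReal (L * B))) :=
    (ENNReal.tendsto_ofReal (tendsto_id.mul_const B)).mono_left nhdsWithin_le_nhds
  exact le_of_tendsto h2 (eventually_mem_nhdsWithin.mono h1)

lemma IsOpen.exists_rat_Icc_subset {U : Set ℝ} (hU : IsOpen U) {x : ℝ} (hx : x ∈ U) :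
    ∃ p q : ℚ, x ∈ Ioo (p : ℝ) q ∧ Icc (p : ℝ) q ⊆ U := by
  obtain ⟨δ, hδ, hb⟩ := Metric.isOpen_iff.1 hU x hx
  obtain ⟨p, hp1, hp2⟩ := exists_rat_btwn (sub_lt_self x hδ)
  obtain ⟨q, hq1, hq2⟩ := exists_rat_btwn (lt_add_of_pos_right x hδ)
  refine ⟨p, q, ⟨hp2, hq1⟩, fun y hy => hb ?_⟩
  rw [Metric.mem_ball, Real.dist_eq, abs_lt]
  constructor <;> linarith [hy.1, hy.2]

lemma LocACOn.ae_hasDerivAt {f f' : ℝ → ℝ} {U : Set ℝ} (hU : IsOpen U) (h : LocACOn f f' U) :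
    ∀ᵐ x, x ∈ U → HasDerivAt f (f' x) x := by
  have h1 : ∀ᵐ x : ℝ, ∀ p q : ℚ, (p : ℝ) ≤ q → Icc (p : ℝ) q ⊆ U → x ∈ Ioo (p : ℝ) q →
      HasDerivAt f (f' x) x := by
    refine ae_all_iff.2 fun p => ae_all_iff.2 fun q => ?_
    by_cases hpq : (p : ℝ) ≤ q ∧ Icc (p : ℝ) q ⊆ U
    · filter_upwards [(h p q hpq.1 hpq.2).ae_hasDerivAt hpq.1] with x hx _ _ hxm using hx hxm
    · exact ae_of_all _ fun x a b => absurd ⟨a, b⟩ hpq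
  filter_upwards [h1] with x hx hxU
  obtain ⟨p, q, hm, hs⟩ := hU.exists_rat_Icc_subset hxU
  exact hx p q (hm.1.trans hm.2).le hs hm

lemma LocACOn.continuousOn {f f' : ℝ → ℝ} {U : Set ℝ} (hU : IsOpen U) (h : LocACOn f f' U) :
    ContinuousOn f U := by
  intro x hx
  obtain ⟨p, q, hm, hs⟩ := hU.exists_rat_Icc_subset hx
  have hpq := (hm.1.trans hm.2).le
  exact (((h p q hpq hs).continuousOn hpq).continuousAt
    (Icc_mem_nhds hm.1 hm.2)).continuousWithinAt

lemma exists_subseq_ae_tendsto_of_lintegral {α : Type*} [MeasurableSpace α] {μ : Measure α}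
    {f : ℕ → α → ℝ} {g : α → ℝ} (hf : ∀ n, AEStronglyMeasurable (f n) μ)
    (hg : AEStronglyMeasurable g μ)
    (hfg : Tendsto (fun n => ∫⁻ x, ENNReal.ofReal |f n x - g x| ∂μ) atTop (𝓝 0)) :
    ∃ ns : ℕ → ℕ, StrictMono ns ∧
      ∀ᵐ x ∂μ, Tendsto (fun i => f (ns i) x) atTop (𝓝 (g x)) := by
  refine (tendstoInMeasure_of_tendsto_eLpNorm one_ne_zero hf hg ?_).exists_seq_tendsto_ae
  simpa [eLpNorm_one_eq_lintegral_enorm, Real.enorm_eq_ofReal_abs] using hfg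

lemma exists_add_notMem_of_measure_zero {ι : Type*} [Countable ι] (s : ι → ℝ) {N : Set ℝ}
    (hN : volume N = 0) : ∃ t : ℝ, ∀ i, t + s i ∉ N := by
  have h : ∀ᵐ t : ℝ, ∀ i, t + s i ∉ N := ae_all_iff.2 fun i =>
    (measurePreserving_add_right volume (s i)).quasiMeasurePreserving.ae
      (measure_eq_zero_iff_ae_notMem.1 hN)
  exact h.exists

/-- The points of the grid of mesh `1 / (k + 1)` through `t`. -/
noncomputable def gridPoint (t : ℝ) (k : ℕ) (j : ℤ) : ℝ := t + j • ((k : ℝ) + 1)⁻¹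

section Grid

variable (t : ℝ) (k : ℕ)

lemma gridPoint_succ_sub (j : ℤ) :
    gridPoint t k (j + 1) - gridPoint t k j = ((k : ℝ) + 1)⁻¹ := by
  simp only [gridPoint, zsmul_eq_mul]; push_cast; ring

lemma gridPoint_lt_succ (j : ℤ) : gridPoint t k j < gridPoint t k (j + 1) := by
  rw [← sub_pos, gridPoint_succ_sub]; positivity

lemma pairwise_disjoint_Ioc_gridPoint :
    Pairwise (Function.onFun Disjoint fun j => Ioc (gridPoint t k j) (gridPoint t k (j + 1))) :=
  pairwise_disjoint_Ioc_add_zsmul t _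

lemma exists_mem_Ioc_gridPoint (x : ℝ) :
    ∃ j, x ∈ Ioc (gridPoint t k j) (gridPoint t k (j + 1)) := by
  have h := iUnion_Ioc_add_zsmul (show 0 < ((k : ℝ) + 1)⁻¹ by positivity) t
  exact mem_iUnion.1 (h ▸ mem_univ x)

/-- The index of the grid cell containing `x`. -/
noncomputable def gridIndex (x : ℝ) : ℤ := (exists_mem_Ioc_gridPoint t k x).choose

/-- The left end of the grid cell containing `x`. -/
noncomputable def cellLeft (x : ℝ) : ℝ := gridPoint t k (gridIndex t k x)

/-- The right end of the grid cell containing `x`. -/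
noncomputable def cellRight (x : ℝ) : ℝ := gridPoint t k (gridIndex t k x + 1)

lemma mem_Ioc_cell (x : ℝ) : x ∈ Ioc (cellLeft t k x) (cellRight t k x) :=
  (exists_mem_Ioc_gridPoint t k x).choose_spec

lemma cellRight_sub_cellLeft (x : ℝ) : cellRight t k x - cellLeft t k x = ((k : ℝ) + 1)⁻¹ :=
  gridPoint_succ_sub t k _

lemma tendsto_mesh : Tendsto (fun k : ℕ => ((k : ℝ) + 1)⁻¹) atTop (𝓝 0) := by
  simpa using tendsto_one_div_add_atTop_nhds_zero_nat (𝕜 := ℝ)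

lemma tendsto_cellLeft (x : ℝ) : Tendsto (fun k => cellLeft t k x) atTop (𝓝 x) := by
  refine tendsto_of_tendsto_of_tendsto_of_le_of_le
    (by simpa using (tendsto_const_nhds (x := x)).sub tendsto_mesh) tendsto_const_nhds
    (fun k => ?_) (fun k => (mem_Ioc_cell t k x).1.le)
  linarith [(mem_Ioc_cell t k x).2, cellRight_sub_cellLeft t k x]

lemma tendsto_cellRight (x : ℝ) : Tendsto (fun k => cellRight t k x) atTop (𝓝 x) := by
  refine tendsto_of_tendsto_of_tendsto_of_le_of_le tendsto_const_nhds
    (by simpa using (tendsto_const_nhds (x := x)).add tendsto_mesh)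
    (fun k => (mem_Ioc_cell t k x).2) (fun k => ?_)
  linarith [(mem_Ioc_cell t k x).1, cellRight_sub_cellLeft t k x]

lemma eventually_forall_mem_cell {x : ℝ} {p : ℝ → Prop} (hp : ∀ᶠ y in 𝓝 x, p y) :
    ∀ᶠ k in atTop, ∀ y ∈ Icc (cellLeft t k x) (cellRight t k x), p y := by
  have h := (tendsto_cellLeft t x).Icc (tendsto_cellRight t x)
  exact h.eventually hp.smallSets

lemma finite_setOf_gridPoint_mem_Icc (a b : ℝ) : {j : ℤ | gridPoint t k j ∈ Icc a b}.Finite := by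
  have hk : (0 : ℝ) < (k : ℝ) + 1 := by positivity
  refine (finite_Icc ⌊(a - t) * (k + 1)⌋ ⌈(b - t) * (k + 1)⌉).subset fun j hj => ?_
  simp only [gridPoint, mem_ofPred_eq, zsmul_eq_mul, ← div_eq_mul_inv, mem_Icc] at hj
  have h1 : (a - t) * (k + 1) ≤ j := by rw [← le_div_iff₀ hk]; linarith [hj.1]
  have h2 : (j : ℝ) ≤ (b - t) * (k + 1) := by rw [← div_le_iff₀ hk]; linarith [hj.2]
  constructor
  · exact_mod_cast (Int.floor_le _).trans h1
  · exact_mod_cast h2.trans (Int.le_ceil _)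

end Grid

/-- The infimum of the weight `ω` on `(a, b]`, disregarding the exceptional set `S`. -/
noncomputable def cellWeight (ω : ℝ → ℝ) (S : Set ℝ) (a b : ℝ) : ℝ := sInf (ω '' (Ioc a b \ S))

lemma cellWeight_nonneg {ω : ℝ → ℝ} {S : Set ℝ} {a b : ℝ} (h : ∀ x ∈ Ioc a b, 0 ≤ ω x) :
    0 ≤ cellWeight ω S a b :=
  Real.sInf_nonneg (by rintro _ ⟨x, hx, rfl⟩; exact h x hx.1)

lemma ae_cellWeight_le {ω : ℝ → ℝ} {S : Set ℝ} (hS : S.Finite) {a b : ℝ}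
    (h : ∀ x ∈ Ioc a b, 0 ≤ ω x) :
    ∀ᵐ x ∂volume.restrict (Ioc a b), cellWeight ω S a b ≤ ω x := by
  filter_upwards [ae_restrict_mem measurableSet_Ioc,
    ae_restrict_of_ae (measure_eq_zero_iff_ae_notMem.1 (hS.measure_zero volume))] with x hx hxS
  exact csInf_le ⟨0, by rintro _ ⟨y, hy, rfl⟩; exact h y hy.1⟩ ⟨x, ⟨hx, hxS⟩, rfl⟩

lemma eventually_le_cellWeight {ω : ℝ → ℝ} {S : Set ℝ} {t x a : ℝ}
    (hgrid : ∀ k j, gridPoint t k j ∉ S) (h : ∀ᶠ y in 𝓝 x, y ∉ S → a ≤ ω y) :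
    ∀ᶠ k in atTop, a ≤ cellWeight ω S (cellLeft t k x) (cellRight t k x) := by
  filter_upwards [eventually_forall_mem_cell t h] with k hk
  refine le_csInf ⟨_, cellRight t k x, ⟨⟨gridPoint_lt_succ t k _, le_rfl⟩, hgrid _ _⟩, rfl⟩ ?_
  rintro _ ⟨y, hy, rfl⟩
  exact hk y (Ioc_subset_Icc_self hy.1) hy.2

/-- The lower bound for the energy on the cell `(a, b]` at the threshold `1 - η`. -/
noncomputable def cellBound (ω u : ℝ → ℝ) (S : Set ℝ) (η a b : ℝ) : ℝ :=
  cellWeight ω S a b * min ((1 - η) ^ 2 * ((u b - u a) ^ 2 / (b - a))) (η ^ 2)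

lemma le_liminf_cellBound_of_hasDerivAt {ω u : ℝ → ℝ} {S : Set ℝ} {t x η u' : ℝ} (hη : 0 < η)
    (hgrid : ∀ k j, gridPoint t k j ∉ S) (hω : ContinuousAt ω x) (hu : HasDerivAt u u' x) :
    ENNReal.ofReal ((1 - η) ^ 2) * ENNReal.ofReal (u' ^ 2 * ω x) ≤
      liminf (fun k : ℕ => ENNReal.ofReal
        (cellBound ω u S η (cellLeft t k x) (cellRight t k x) / ((k : ℝ) + 1)⁻¹)) atTop := by
  have hq := hu.tendsto_slope_straddle (tendsto_cellLeft t x) (tendsto_cellRight t x)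
    (fun k => (mem_Ioc_cell t k x).1.le) (fun k => (mem_Ioc_cell t k x).2)
    (fun k => gridPoint_lt_succ t k _)
  have hq2 := (hq.pow 2).const_mul ((1 - η) ^ 2)
  have hinf : Tendsto (fun k : ℕ => η ^ 2 * ((k : ℝ) + 1)) atTop atTop :=
    (tendsto_atTop_add_const_right _ _ tendsto_natCast_atTop_atTop).const_mul_atTop (by positivity)
  have hb : Tendsto (fun k : ℕ => min ((1 - η) ^ 2 * ((u (cellRight t k x) - u (cellLeft t k x)) /
      (cellRight t k x - cellLeft t k x)) ^ 2) (η ^ 2 * ((k : ℝ) + 1))) atTop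
      (𝓝 ((1 - η) ^ 2 * u' ^ 2)) := by
    refine hq2.congr' ?_
    filter_upwards [hq2.eventually_lt_const (lt_add_one _), hinf.eventually_ge_atTop _] with k h1 h2
    exact (min_eq_left (h1.le.trans h2)).symm
  have key := ofReal_mul_le_liminf (L := ω x)
    (m := fun k => cellWeight ω S (cellLeft t k x) (cellRight t k x))
    (fun a ha => eventually_le_cellWeight hgrid
      ((hω.eventually (lt_mem_nhds ha)).mono fun y hy _ => le_of_lt hy)) hb
    (fun k => le_min (by positivity) (by positivity))
  rw [← ENNReal.ofReal_mul (sq_nonneg _)]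
  convert key using 2
  · ring
  · ext k
    have hk : (0 : ℝ) < (k : ℝ) + 1 := by positivity
    congr 1
    rw [cellBound, cellRight_sub_cellLeft, mul_div_assoc, ← min_div_div_right (by positivity)]
    congr 2 <;> field_simp

lemma le_liminf_cellBound_of_jump {ω u : ℝ → ℝ} {S : Set ℝ} {t x η l r L : ℝ}
    (hη0 : 0 < η) (hgrid : ∀ k j, gridPoint t k j ∉ S) (hx : x ∈ S)
    (hω : ∀ a < L, ∀ᶠ y in 𝓝 x, y ∉ S → a ≤ ω y) (hl : Tendsto u (𝓝[<] x) (𝓝 l))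
    (hr : Tendsto u (𝓝[>] x) (𝓝 r)) (hlr : l ≠ r) :
    ENNReal.ofReal ((1 - η) ^ 2) * ENNReal.ofReal L ≤
      liminf (fun k : ℕ => ENNReal.ofReal
        (cellBound ω u S (1 - η) (cellLeft t k x) (cellRight t k x))) atTop := by
  have hl' : Tendsto (fun k => u (cellLeft t k x)) atTop (𝓝 l) :=
    hl.comp (tendsto_nhdsWithin_iff.2 ⟨tendsto_cellLeft t x,
      Eventually.of_forall fun k => (mem_Ioc_cell t k x).1⟩)
  have hr' : Tendsto (fun k => u (cellRight t k x)) atTop (𝓝 r) :=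
    hr.comp (tendsto_nhdsWithin_iff.2 ⟨tendsto_cellRight t x, Eventually.of_forall fun k =>
      lt_of_le_of_ne (mem_Ioc_cell t k x).2 fun h => hgrid k _ (h ▸ hx)⟩)
  have hpos : 0 < η ^ 2 * (r - l) ^ 2 := by
    have := sub_ne_zero.2 hlr.symm
    positivity
  have hinf : Tendsto (fun k : ℕ => η ^ 2 * (u (cellRight t k x) - u (cellLeft t k x)) ^ 2 *
      ((k : ℝ) + 1)) atTop atTop :=
    (((hr'.sub hl').pow 2).const_mul (η ^ 2)).pos_mul_atTop hpos
      (tendsto_atTop_add_const_right _ _ tendsto_natCast_atTop_atTop)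
  have hb : Tendsto (fun k : ℕ => min (η ^ 2 * (u (cellRight t k x) - u (cellLeft t k x)) ^ 2 *
      ((k : ℝ) + 1)) ((1 - η) ^ 2)) atTop (𝓝 ((1 - η) ^ 2)) := by
    refine tendsto_const_nhds.congr' ?_
    filter_upwards [hinf.eventually_ge_atTop ((1 - η) ^ 2)] with k h
    exact (min_eq_right h).symm
  have key := ofReal_mul_le_liminf
    (m := fun k => cellWeight ω S (cellLeft t k x) (cellRight t k x))
    (fun a ha => eventually_le_cellWeight hgrid (hω a ha)) hb
    (fun k => le_min (by positivity) (by positivity))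
  rw [← ENNReal.ofReal_mul (sq_nonneg _), mul_comm]
  convert key using 4 with k
  rw [cellBound, cellRight_sub_cellLeft]
  congr 2
  field_simp
  ring

lemma liminf_add_liminf_le (f g : ℕ → ℝ≥0∞) :
    liminf f atTop + liminf g atTop ≤ liminf (fun k => f k + g k) atTop := by
  have hmono : ∀ f : ℕ → ℝ≥0∞, Monotone fun n => ⨅ i, ⨅ (_ : i ≥ n), f i := fun f a b hab =>
    le_iInf₂ fun i hi => iInf₂_le i (hab.trans hi)
  simp only [liminf_eq_iSup_iInf_of_nat]
  rw [ENNReal.iSup_add_iSup_of_monotone (hmono f) (hmono g)]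
  exact iSup_mono fun n => le_iInf₂ fun i hi => add_le_add (iInf₂_le i hi) (iInf₂_le i hi)

lemma sum_liminf_le {ι : Type*} (s : Finset ι) (f : ι → ℕ → ℝ≥0∞) :
    ∑ i ∈ s, liminf (f i) atTop ≤ liminf (fun k => ∑ i ∈ s, f i k) atTop := by
  classical
  induction s using Finset.induction_on with
  | empty => simp
  | insert i s hi ih =>
    simp only [Finset.sum_insert hi]
    exact (add_le_add le_rfl ih).trans (liminf_add_liminf_le _ _)

/-- Fatou's lemma on the grid cells contained in `I \ S`. -/
lemma lintegral_le_liminf_sum_cellBound {I S Sω : Set ℝ} (hI : IsOpen I) (hIm : MeasurableSet I)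
    (hS : S.Finite) (hSω : Sω.Finite) {ω u u' : ℝ → ℝ} (hωc : ContinuousOn ω (I \ Sω))
    (hu : LocACOn u u' (I \ S)) {t η : ℝ} (hη : 0 < η) (hgrid : ∀ k j, gridPoint t k j ∉ S)
    (T : ℕ → Finset ℤ)
    (hT : ∀ k j, Icc (gridPoint t k j) (gridPoint t k (j + 1)) ⊆ I \ S → j ∈ T k) :
    ENNReal.ofReal ((1 - η) ^ 2) * ∫⁻ x in I, ENNReal.ofReal ((u' x) ^ 2 * ω x) ≤
      liminf (fun k => ∑ j ∈ T k, ENNReal.ofReal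
        (cellBound ω u S η (gridPoint t k j) (gridPoint t k (j + 1)))) atTop := by
  set F : ℕ → ℝ → ℝ≥0∞ := fun k x => ∑ j ∈ T k,
    (Ioc (gridPoint t k j) (gridPoint t k (j + 1))).indicator (fun _ => ENNReal.ofReal
      (cellBound ω u S η (gridPoint t k j) (gridPoint t k (j + 1)) / ((k : ℝ) + 1)⁻¹)) x with hF
  have hFm : ∀ k, Measurable (F k) := fun k =>
    Finset.measurable_fun_sum _ fun j _ => measurable_const.indicator measurableSet_Ioc
  have hFint : ∀ k, ∫⁻ x in I, F k x ≤ ∑ j ∈ T k, ENNReal.ofReal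
      (cellBound ω u S η (gridPoint t k j) (gridPoint t k (j + 1))) := by
    intro k
    refine (setLIntegral_le_lintegral _ _).trans ?_
    rw [hF, lintegral_finsetSum _ fun j _ => measurable_const.indicator measurableSet_Ioc]
    refine Finset.sum_le_sum fun j _ => le_of_eq ?_
    have hk : (0 : ℝ) < ((k : ℝ) + 1)⁻¹ := by positivity
    rw [lintegral_indicator_const measurableSet_Ioc, Real.volume_Ioc, gridPoint_succ_sub,
      ← ENNReal.ofReal_mul' hk.le, div_mul_cancel₀ _ hk.ne']
  have hU : IsOpen (I \ S) := hI.sdiff hS.isClosed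
  have hV : IsOpen (I \ Sω) := hI.sdiff hSω.isClosed
  rw [← lintegral_const_mul' _ _ ENNReal.ofReal_ne_top]
  refine le_trans ?_ ((lintegral_liminf_le hFm).trans
    (liminf_le_liminf (Eventually.of_forall hFint)))
  refine lintegral_mono_ae ?_
  filter_upwards [ae_restrict_mem hIm, ae_restrict_of_ae (hu.ae_hasDerivAt hU),
    ae_restrict_of_ae (measure_eq_zero_iff_ae_notMem.1 (hS.measure_zero volume)),
    ae_restrict_of_ae (measure_eq_zero_iff_ae_notMem.1 (hSω.measure_zero volume))]
    with x hxI hxu hxS hxω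
  refine (le_liminf_cellBound_of_hasDerivAt hη hgrid
    (hωc.continuousAt (hV.mem_nhds ⟨hxI, hxω⟩)) (hxu ⟨hxI, hxS⟩)).trans (liminf_le_liminf ?_)
  filter_upwards [eventually_forall_mem_cell t (hU.mem_nhds ⟨hxI, hxS⟩)] with k hk
  refine le_trans (le_of_eq ?_) (Finset.single_le_sum (fun _ _ => zero_le)
    (hT k (gridIndex t k x) hk))
  exact (indicator_of_mem (mem_Ioc_cell t k x) (fun _ => ENNReal.ofReal
    (cellBound ω u S η (cellLeft t k x) (cellRight t k x) / ((k : ℝ) + 1)⁻¹))).symm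

/-- The inequality when the sequences converge almost everywhere with energies at most `A`. -/
lemma energy_le_of_ae_tendsto {I : Set ℝ} (hI : IsOpen I) (hIb : Bornology.IsBounded I)
    {ω ωl ωr : ℝ → ℝ} (hω0 : ∀ x ∈ I, 0 ≤ ω x) {Sω S : Set ℝ} (hSω : Sω.Finite)
    (hωc : ContinuousOn ω (I \ Sω))
    (hωlim : ∀ x ∈ I, Tendsto ω (𝓝[<] x) (𝓝 (ωl x)) ∧ Tendsto ω (𝓝[>] x) (𝓝 (ωr x)))
    (hS : S.Finite) (hSI : S ⊆ I) {u u' : ℝ → ℝ} (hu : LocACOn u u' (I \ S))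
    (hjump : ∀ x ∈ S, ∃ l r : ℝ,
      Tendsto u (𝓝[<] x) (𝓝 l) ∧ Tendsto u (𝓝[>] x) (𝓝 r) ∧ l ≠ r)
    {ε : ℕ → ℝ} (hε : ∀ n, 0 < ε n) {un gn vn hn : ℕ → ℝ → ℝ}
    (hun : ∀ n, LocACOn (un n) (gn n) I) (hvn : ∀ n, LocACOn (vn n) (hn n) I)
    (hunlim : ∀ᵐ x ∂volume.restrict I, Tendsto (fun n => un n x) atTop (𝓝 (u x)))
    (hvnlim : ∀ᵐ x ∂volume.restrict I, Tendsto (fun n => vn n x) atTop (𝓝 1))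
    {A : ℝ≥0∞} (hA : ∀ n, (∫⁻ x in I, ENNReal.ofReal ((vn n x) ^ 2 * (gn n x) ^ 2 * ω x)) +
      ∫⁻ x in I, ENNReal.ofReal (((ε n / 2) * (hn n x) ^ 2 +
        (1 / (2 * ε n)) * (vn n x - 1) ^ 2) * ω x) ≤ A) :
    (∫⁻ x in I, ENNReal.ofReal ((u' x) ^ 2 * ω x)) +
      ∑ x ∈ hS.toFinset, ENNReal.ofReal (min (ωl x) (ωr x)) ≤ A := by
  classical
  suffices h : ∀ η ∈ Ioo (0 : ℝ) 1, ENNReal.ofReal ((1 - η) ^ 2) *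
      ((∫⁻ x in I, ENNReal.ofReal ((u' x) ^ 2 * ω x)) +
        ∑ x ∈ hS.toFinset, ENNReal.ofReal (min (ωl x) (ωr x))) ≤ A by
    have hlim : Tendsto (fun η : ℝ => ENNReal.ofReal ((1 - η) ^ 2)) (𝓝[>] 0) (𝓝 1) := by
      have : Continuous fun η : ℝ => ENNReal.ofReal ((1 - η) ^ 2) :=
        ENNReal.continuous_ofReal.comp (by fun_prop)
      simpa using (this.tendsto 0).mono_left nhdsWithin_le_nhds
    have hlim' := ENNReal.Tendsto.mul_const (b := (∫⁻ x in I, ENNReal.ofReal ((u' x) ^ 2 * ω x)) +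
        ∑ x ∈ hS.toFinset, ENNReal.ofReal (min (ωl x) (ωr x))) hlim (Or.inl one_ne_zero)
    rw [one_mul] at hlim'
    exact le_of_tendsto hlim' (mem_of_superset (Ioo_mem_nhdsGT one_pos) h)
  intro η hη
  have hIm := hI.measurableSet
  obtain ⟨t, ht⟩ : ∃ t, ∀ i : ℕ × ℤ, t + i.2 • ((i.1 : ℝ) + 1)⁻¹ ∉
      {x | x ∈ S ∨ (x ∈ I ∧ ¬ (Tendsto (fun n => un n x) atTop (𝓝 (u x)) ∧
        Tendsto (fun n => vn n x) atTop (𝓝 1)))} := by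
    refine exists_add_notMem_of_measure_zero _ (measure_eq_zero_iff_ae_notMem.2 ?_)
    filter_upwards [(ae_restrict_iff' hIm).1 hunlim, (ae_restrict_iff' hIm).1 hvnlim,
      measure_eq_zero_iff_ae_notMem.1 (hS.measure_zero volume)] with x h1 h2 h3
    rintro (h | ⟨hxI, h⟩)
    · exact h3 h
    · exact h ⟨h1 hxI, h2 hxI⟩
  have hgrid : ∀ k j, gridPoint t k j ∉ S := fun k j h => ht (k, j) (Or.inl h)
  have hgood : ∀ k j, gridPoint t k j ∈ I →
      Tendsto (fun n => un n (gridPoint t k j)) atTop (𝓝 (u (gridPoint t k j))) ∧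
        Tendsto (fun n => vn n (gridPoint t k j)) atTop (𝓝 1) := fun k j h => by
    by_contra hc
    exact ht (k, j) (Or.inr ⟨h, hc⟩)
  have hfin : ∀ k, {j | Icc (gridPoint t k j) (gridPoint t k (j + 1)) ⊆ I}.Finite := fun k => by
    obtain ⟨a, ha⟩ := hIb.bddBelow
    obtain ⟨b, hb⟩ := hIb.bddAbove
    refine (finite_setOf_gridPoint_mem_Icc t k a b).subset fun j hj => ?_
    have := hj ⟨le_rfl, (gridPoint_lt_succ t k j).le⟩
    exact ⟨ha this, hb this⟩
  set bulk : ℕ → ℤ → Prop := fun k j =>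
    Icc (gridPoint t k j) (gridPoint t k (j + 1)) ⊆ I \ S with hbulk
  set P : ℕ → ℝ≥0∞ := fun k => ∑ j ∈ (hfin k).toFinset with bulk k j, ENNReal.ofReal
    (cellBound ω u S η (gridPoint t k j) (gridPoint t k (j + 1))) with hP
  set R : ℕ → ℝ≥0∞ := fun k => ∑ x ∈ hS.toFinset, ENNReal.ofReal
    (cellBound ω u S (1 - η) (cellLeft t k x) (cellRight t k x)) with hR
  have hPle : ENNReal.ofReal ((1 - η) ^ 2) * ∫⁻ x in I, ENNReal.ofReal ((u' x) ^ 2 * ω x) ≤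
      liminf P atTop :=
    lintegral_le_liminf_sum_cellBound hI hIm hS hSω hωc hu hη.1 hgrid _ fun k j hj =>
      Finset.mem_filter.2 ⟨(hfin k).mem_toFinset.2 (hj.trans sdiff_subset), hj⟩
  have hRle : ENNReal.ofReal ((1 - η) ^ 2) *
      ∑ x ∈ hS.toFinset, ENNReal.ofReal (min (ωl x) (ωr x)) ≤ liminf R atTop := by
    rw [Finset.mul_sum]
    refine (Finset.sum_le_sum fun x hx => ?_).trans (sum_liminf_le _ _)
    have hxS := hS.mem_toFinset.1 hx
    obtain ⟨l, r, hl, hr, hlr⟩ := hjump x hxS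
    refine le_liminf_cellBound_of_jump hη.1 hgrid hxS (fun a ha => ?_) hl hr hlr
    obtain ⟨h1, h2⟩ := hωlim x (hSI hxS)
    have h3 : ∀ᶠ y in 𝓝[≠] x, a ≤ ω y := by
      rw [← nhdsLT_sup_nhdsGT, eventually_sup]
      exact ⟨h1.eventually_const_le (ha.trans_le (min_le_left _ _)),
        h2.eventually_const_le (ha.trans_le (min_le_right _ _))⟩
    filter_upwards [eventually_nhdsWithin_iff.1 h3] with y hy hyS
    exact hy fun h => hyS (h ▸ hxS)
  have hPR : ∀ᶠ k in atTop, P k + R k ≤ A := by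
    have hcell : ∀ᶠ k in atTop, ∀ x ∈ S, ∀ y ∈ Icc (cellLeft t k x) (cellRight t k x),
        y ∈ I ∧ (y ∈ S → y = x) := by
      refine (hS.eventually_all).2 fun x hx => eventually_forall_mem_cell t ?_
      have h1 : ∀ᶠ y in 𝓝 x, y ∉ S \ {x} :=
        (hS.subset sdiff_subset).isClosed.isOpen_compl.mem_nhds fun h => h.2 rfl
      filter_upwards [hI.mem_nhds (hSI hx), h1] with y hy1 hy2
      exact ⟨hy1, fun hyS => by_contra fun hne => hy2 ⟨hyS, hne⟩⟩
    filter_upwards [hcell] with k hk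
    have hsub : ∀ j ∈ (hfin k).toFinset, Icc (gridPoint t k j) (gridPoint t k (j + 1)) ⊆ I :=
      fun j hj => (hfin k).mem_toFinset.1 hj
    have hsub' : ∀ j ∈ (hfin k).toFinset, ∀ x ∈ Ioc (gridPoint t k j) (gridPoint t k (j + 1)),
        0 ≤ ω x := fun j hj x hx => hω0 x (hsub j hj (Ioc_subset_Icc_self hx))
    have hsum := sum_ofReal_min_le_of_energy_le (hfin k).toFinset (U := I)
      (c := fun j => gridPoint t k j) (d := fun j => gridPoint t k (j + 1)) (u := u)
      (fun j _ => gridPoint_lt_succ t k j) hsub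
      ((pairwise_disjoint_Ioc_gridPoint t k).set_pairwise _) hun hvn hε
      (m := fun j => cellWeight ω S (gridPoint t k j) (gridPoint t k (j + 1)))
      (η := fun j => if bulk k j then η else 1 - η)
      (fun j hj => cellWeight_nonneg (hsub' j hj))
      (fun j _ => by split_ifs <;> linarith [hη.1, hη.2])
      (fun j _ => by split_ifs <;> linarith [hη.1, hη.2])
      (fun j hj => ae_cellWeight_le hS (hsub' j hj))
      (fun j hj => hgood k j (hsub j hj ⟨le_rfl, (gridPoint_lt_succ t k j).le⟩))
      (fun j hj => hgood k _ (hsub j hj ⟨(gridPoint_lt_succ t k j).le, le_rfl⟩)) hA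
    refine le_trans ?_ hsum
    rw [← Finset.sum_filter_add_sum_filter_not _ (bulk k)]
    refine add_le_add (le_of_eq ?_) ?_
    · refine Finset.sum_congr rfl fun j hj => ?_
      rw [if_pos (Finset.mem_filter.1 hj).2, cellBound]
    · have hinj : Set.InjOn (gridIndex t k) hS.toFinset := fun x hx y hy hxy => by
        have hy' := mem_Ioc_cell t k y
        rw [cellLeft, cellRight, ← hxy] at hy'
        exact ((hk x (hS.mem_toFinset.1 hx) y (Ioc_subset_Icc_self hy')).2
          (hS.mem_toFinset.1 hy)).symm
      have hnot : ∀ x ∈ S, ¬ bulk k (gridIndex t k x) := fun x hx hb =>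
        (hb (Ioc_subset_Icc_self (mem_Ioc_cell t k x))).2 hx
      calc R k = ∑ j ∈ hS.toFinset.image (gridIndex t k), ENNReal.ofReal
            (cellBound ω u S (1 - η) (gridPoint t k j) (gridPoint t k (j + 1))) := by
            rw [Finset.sum_image hinj]; rfl
        _ ≤ ∑ j ∈ (hfin k).toFinset with ¬ bulk k j, ENNReal.ofReal
            (cellBound ω u S (1 - η) (gridPoint t k j) (gridPoint t k (j + 1))) := by
            refine Finset.sum_le_sum_of_subset fun j hj => ?_
            obtain ⟨x, hx, rfl⟩ := Finset.mem_image.1 hj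
            have hxS := hS.mem_toFinset.1 hx
            exact Finset.mem_filter.2
              ⟨(hfin k).mem_toFinset.2 fun y hy => (hk x hxS y hy).1, hnot x hxS⟩
        _ = _ := Finset.sum_congr rfl fun j hj => by
            rw [if_neg (Finset.mem_filter.1 hj).2, cellBound]
  calc _ ≤ liminf P atTop + liminf R atTop := by rw [mul_add]; exact add_le_add hPle hRle
    _ ≤ liminf (fun k => P k + R k) atTop := liminf_add_liminf_le P R
    _ ≤ liminf (fun _ : ℕ => A) atTop := liminf_le_liminf hPR
    _ = A := liminf_const A

/-- Γ-liminf inequality for the one-dimensional weighted Ambrosio–Tortorelli functionals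
with an `SBV` weight `1 ≤ ω ≤ C` on `I = (-1, 1)`: the weight has finitely many jump
points, one-sided limits `ωl x`, `ωr x` at every point of `I`, and the jump energy is
charged with the lower trace `ω⁻(x) = min (ωl x) (ωr x)`. -/
theorem gamma_liminf_sbv_weight_1d
    (C : ℝ) (hC : 1 ≤ C)
    (ω : ℝ → ℝ)
    (hω1 : ∀ x ∈ Set.Ioo (-1 : ℝ) 1, 1 ≤ ω x ∧ ω x ≤ C)
    (Sω : Set ℝ) (hSω : Sω.Finite) (hSωI : Sω ⊆ Set.Ioo (-1 : ℝ) 1)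
    (hωc : ContinuousOn ω (Set.Ioo (-1 : ℝ) 1 \ Sω))
    (ωl ωr : ℝ → ℝ)
    (hωlim : ∀ x ∈ Set.Ioo (-1 : ℝ) 1,
      Tendsto ω (nhdsWithin x (Set.Iio x)) (nhds (ωl x)) ∧
      Tendsto ω (nhdsWithin x (Set.Ioi x)) (nhds (ωr x)))
    (S : Set ℝ) (hS : S.Finite) (hSI : S ⊆ Set.Ioo (-1 : ℝ) 1)
    (u u' : ℝ → ℝ)
    (hu : LocACOn u u' (Set.Ioo (-1 : ℝ) 1 \ S))
    (hjump : ∀ x ∈ S, ∃ l r : ℝ,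
      Tendsto u (nhdsWithin x (Set.Iio x)) (nhds l) ∧
      Tendsto u (nhdsWithin x (Set.Ioi x)) (nhds r) ∧ l ≠ r)
    (ε : ℕ → ℝ) (hεpos : ∀ n, 0 < ε n) (hε0 : Tendsto ε atTop (nhds 0))
    (un gn vn hn : ℕ → ℝ → ℝ)
    (hunAC : ∀ n, LocACOn (un n) (gn n) (Set.Ioo (-1 : ℝ) 1))
    (hvnAC : ∀ n, LocACOn (vn n) (hn n) (Set.Ioo (-1 : ℝ) 1))
    (hv01 : ∀ n, ∀ x ∈ Set.Ioo (-1 : ℝ) 1, 0 ≤ vn n x ∧ vn n x ≤ 1)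
    (huL1 : Tendsto (fun n => ∫⁻ x in Set.Ioo (-1 : ℝ) 1,
      ENNReal.ofReal (|un n x - u x| * ω x)) atTop (nhds 0))
    (hvL1 : Tendsto (fun n => ∫⁻ x in Set.Ioo (-1 : ℝ) 1,
      ENNReal.ofReal |vn n x - 1|) atTop (nhds 0)) :
    (∫⁻ x in Set.Ioo (-1 : ℝ) 1, ENNReal.ofReal ((u' x) ^ 2 * ω x)) +
        ∑ x ∈ hS.toFinset, ENNReal.ofReal (min (ωl x) (ωr x)) ≤
      Filter.liminf (fun n =>
        (∫⁻ x in Set.Ioo (-1 : ℝ) 1,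
          ENNReal.ofReal ((vn n x) ^ 2 * (gn n x) ^ 2 * ω x)) +
        ∫⁻ x in Set.Ioo (-1 : ℝ) 1,
          ENNReal.ofReal (((ε n / 2) * (hn n x) ^ 2 +
            (1 / (2 * ε n)) * (vn n x - 1) ^ 2) * ω x)) atTop := by
  refine le_of_forall_gt_imp_ge_of_dense fun A hA => ?_
  have hIo : IsOpen (Ioo (-1 : ℝ) 1) := isOpen_Ioo
  have hIm : MeasurableSet (Ioo (-1 : ℝ) 1) := measurableSet_Ioo
  have hunm : ∀ n, AEStronglyMeasurable (un n) (volume.restrict (Ioo (-1 : ℝ) 1)) := fun n =>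
    ((hunAC n).continuousOn hIo).aestronglyMeasurable hIm
  have hvnm : ∀ n, AEStronglyMeasurable (vn n) (volume.restrict (Ioo (-1 : ℝ) 1)) := fun n =>
    ((hvnAC n).continuousOn hIo).aestronglyMeasurable hIm
  have hum : AEStronglyMeasurable u (volume.restrict (Ioo (-1 : ℝ) 1)) := by
    have hU : IsOpen (Ioo (-1 : ℝ) 1 \ S) := hIo.sdiff hS.isClosed
    have h := (hu.continuousOn hU).aestronglyMeasurable (μ := volume) hU.measurableSet
    rwa [Measure.restrict_congr_set (sdiff_null_ae_eq_self (hS.measure_zero volume))] at h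
  have huL1' : Tendsto (fun n => ∫⁻ x in Ioo (-1 : ℝ) 1, ENNReal.ofReal |un n x - u x|)
      atTop (𝓝 0) := by
    refine tendsto_of_tendsto_of_tendsto_of_le_of_le tendsto_const_nhds huL1
      (fun _ => zero_le) fun n => setLIntegral_mono' hIm fun x hx => ENNReal.ofReal_le_ofReal ?_
    exact le_mul_of_one_le_right (abs_nonneg _) (hω1 x hx).1
  obtain ⟨φ, hφ, hφA⟩ := extraction_of_frequently_atTop
    (frequently_lt_of_liminf_lt (by isBoundedDefault) hA)
  obtain ⟨ψ, hψ, hψu⟩ := exists_subseq_ae_tendsto_of_lintegral (fun n => hunm (φ n)) hum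
    (huL1'.comp hφ.tendsto_atTop)
  obtain ⟨χ, hχ, hχv⟩ := exists_subseq_ae_tendsto_of_lintegral (fun n => hvnm (φ (ψ n)))
    (g := fun _ => 1) aestronglyMeasurable_const (hvL1.comp (hφ.comp hψ).tendsto_atTop)
  refine energy_le_of_ae_tendsto hIo (Metric.isBounded_Ioo _ _)
    (fun x hx => zero_le_one.trans (hω1 x hx).1) hSω hωc hωlim hS hSI hu hjump
    (fun n => hεpos (φ (ψ (χ n)))) (fun n => hunAC (φ (ψ (χ n)))) (fun n => hvnAC (φ (ψ (χ n))))
    (hψu.mono fun x hx => hx.comp hχ.tendsto_atTop) hχv fun n => (hφA (ψ (χ n))).le
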